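/- arXiv:2403.19661 — 2 statements merged into one kernel-verified Lean document; each statement's English description precedes it below -/
import Mathlib

section
/- Let Λ be a set of morphisms in a locally presentable category 𝒜. Then the pair (l r(Λ), r(Λ)) is an orthogonal factorization system on 𝒜: every morphism factors as a morphism in l(r(Λ)) followed by a morphism in r(Λ), and l(r(Λ)) ⊥ r(Λ). -/
open CategoryTheory CategoryTheory.Limits Opposite

universe w v u

namespace Paper

variable {C : Type u} [Category.{v} C]

/-- A category is `κ`-filtered if every diagram with fewer than `κ` many morphisms
admits a cocone. -/
def IsCardinalFiltered (κ : Cardinal.{v}) (J : Type v) [Category.{v} J] : Prop :=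
  ∀ (K : Type v) [Category.{v} K],
    Cardinal.mk (Σ (a : K) (b : K), a ⟶ b) < κ → ∀ F : K ⥤ J, Nonempty (Limits.Cocone F)

/-- An object `X` is `κ`-presentable if its hom-functor `Hom(X, -)` preserves
`κ`-filtered colimits. -/
def IsPresentableObj (κ : Cardinal.{v}) (X : C) : Prop :=
  ∀ (J : Type v) [Category.{v} J], IsCardinalFiltered κ J →
    Nonempty (PreservesColimitsOfShape J (coyoneda.obj (op X)))

/-- A category is locally `κ`-presentable if it is cocomplete and has a small family of
`κ`-presentable objects such that every object is a `κ`-filtered colimit of objects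
from this family. -/
def LocallyPresentable (κ : Cardinal.{v}) (C : Type u) [Category.{v} C] : Prop :=
  HasColimits C ∧
    ∃ S : Set C, Small.{v} S ∧ (∀ X ∈ S, IsPresentableObj κ X) ∧
      ∀ X : C, ∃ (J : Type v) (_ : Category.{v} J) (F : J ⥤ C) (c : Limits.Cocone F),
        IsCardinalFiltered κ J ∧ Nonempty (Limits.IsColimit c) ∧ c.pt = X ∧
          ∀ j, F.obj j ∈ S

/-- `e ⊥ m`: every commutative square from `e` to `m` has a unique diagonal filler. -/
def UniqueLift {A B X Y : C} (e : A ⟶ B) (m : X ⟶ Y) : Prop :=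
  ∀ (u : A ⟶ X) (v : B ⟶ Y), u ≫ m = e ≫ v →
    ∃! d : B ⟶ X, e ≫ d = u ∧ d ≫ m = v

/-- `p : X ⟶ Y` is a `κ`-local retraction if every morphism from a `κ`-presentable object
into `Y` lifts along `p`. -/
def IsLocalRetraction (κ : Cardinal.{v}) {X Y : C} (p : X ⟶ Y) : Prop :=
  ∀ (Γ : C), IsPresentableObj κ Γ → ∀ f : Γ ⟶ Y, ∃ g : Γ ⟶ X, g ≫ p = f

/-- The right orthogonal complement of a family of morphisms. -/
def rightOrth {ι : Type w} {A B : ι → C} (g : ∀ i, A i ⟶ B i) : MorphismProperty C :=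
  fun _ _ m => ∀ i, UniqueLift (g i) m

/-- The left orthogonal complement of the right orthogonal complement of a family. -/
def leftRightOrth {ι : Type w} {A B : ι → C} (g : ∀ i, A i ⟶ B i) : MorphismProperty C :=
  fun _ _ e => ∀ ⦃X Y : C⦄ (m : X ⟶ Y), rightOrth g m → UniqueLift e m

open MorphismProperty HomotopicalAlgebra

lemma isCardinalFiltered_iff (κ : Cardinal.{v}) [Fact κ.IsRegular] (J : Type v) [Category.{v} J] :
    IsCardinalFiltered κ J ↔ CategoryTheory.IsCardinalFiltered J κ := by
  have key (K : Type v) [Category.{v} K] :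
      Cardinal.mk (Σ (a : K) (b : K), a ⟶ b) < κ ↔ HasCardinalLT (Arrow K) κ := by
    let e : Arrow K ≃ Σ (a : K) (b : K), a ⟶ b :=
      { toFun f := ⟨f.left, f.right, f.hom⟩
        invFun f := Arrow.mk f.2.2 }
    rw [hasCardinalLT_iff_of_equiv e, hasCardinalLT_iff_cardinal_mk_lt]
  exact ⟨fun h ↦ ⟨fun {K} _ F hK ↦ h K ((key K).2 hK) F⟩,
    fun h K _ hK F ↦ h.nonempty_cocone F ((key K).1 hK)⟩

lemma IsPresentableObj.isCardinalPresentable {κ : Cardinal.{v}} [Fact κ.IsRegular] {X : C}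
    (hX : IsPresentableObj κ X) : IsCardinalPresentable X κ where
  preservesColimitOfShape J _ hJ := (hX J ((isCardinalFiltered_iff κ J).2 hJ)).some

lemma LocallyPresentable.isCardinalLocallyPresentable {κ : Cardinal.{v}} [Fact κ.IsRegular]
    (hC : LocallyPresentable κ C) : IsCardinalLocallyPresentable C κ := by
  obtain ⟨hcolim, S, hS, hpres, hgen⟩ := hC
  let P : ObjectProperty C := fun X ↦ X ∈ S
  have : ObjectProperty.Small.{v} P := hS
  have hP : P.IsCardinalFilteredGenerator κ :=
    { le_isCardinalPresentable := fun X hX ↦ (hpres X hX).isCardinalPresentable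
      exists_colimitsOfShape := fun X ↦ by
        obtain ⟨J, _, F, c, hJ, ⟨hc⟩, rfl, hF⟩ := hgen X
        exact ⟨J, inferInstance, (isCardinalFiltered_iff κ J).1 hJ,
          ⟨{ diag := F, ι := c.ι, isColimit := hc, prop_diag_obj := hF }⟩⟩ }
  have := hP.hasCardinalFilteredGenerator
  exact { toHasColimitsOfSize := hcolim }

lemma exists_isCardinalPresentable {α : Type*} [Small.{v} α] (X : α → C)
    [∀ a, IsPresentable.{v} (X a)] :
    ∃ (κ : Cardinal.{v}) (_ : Fact κ.IsRegular), ∀ a, IsCardinalPresentable (X a) κ := by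
  choose κ hκ hX using fun a ↦ Functor.IsAccessible.exists_cardinal.{v}
    (F := coyoneda.obj (op (X a)))
  obtain ⟨κ', h, hlt⟩ := HasCardinalLT.exists_regular_cardinal_forall.{v}
    (fun a ↦ (κ a).ord.ToType)
  have : Fact κ'.IsRegular := ⟨h⟩
  refine ⟨κ', inferInstance, fun a ↦ isCardinalPresentable_of_le (κ := κ a) _ (le_of_lt ?_)⟩
  simpa [hasCardinalLT_iff_cardinal_mk_lt] using hlt a

instance isSmall_sup (W W' : MorphismProperty C) [MorphismProperty.IsSmall.{v} W]
    [MorphismProperty.IsSmall.{v} W'] : MorphismProperty.IsSmall.{v} (W ⊔ W') := by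
  have (b : Bool) : MorphismProperty.IsSmall.{v} (cond b W W') := by
    cases b <;> assumption
  rw [sup_eq_iSup]
  infer_instance

lemma hasSmallObjectArgument [IsLocallyPresentable.{v} C] [HasColimits C]
    (I : MorphismProperty C) [MorphismProperty.IsSmall.{v} I] :
    HasSmallObjectArgument.{v} I := by
  obtain ⟨κ, hκ, h⟩ := exists_isCardinalPresentable (fun f : I.toSet ↦ f.1.left)
  have : Nonempty κ.ord.ToType := by simpa using hκ.out.ne_zero
  have := WellFoundedLT.toOrderBot κ.ord.ToType
  exact ⟨κ, inferInstance, inferInstance,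
    { preservesColimit := fun {A B _ _} i hi f hf ↦ by
        have : IsCardinalPresentable A κ := h ⟨Arrow.mk i, hi⟩
        have := preservesColimitsOfShape_of_isCardinalPresentable A κ κ.ord.ToType
        infer_instance }⟩

/-- Uniqueness of diagonal fillers in commutative squares from `e` to `m`. -/
def AtMostOneLift {A B X Y : C} (e : A ⟶ B) (m : X ⟶ Y) : Prop :=
  ∀ ⦃d₁ d₂ : B ⟶ X⦄, e ≫ d₁ = e ≫ d₂ → d₁ ≫ m = d₂ ≫ m → d₁ = d₂

lemma uniqueLift_iff {A B X Y : C} (e : A ⟶ B) (m : X ⟶ Y) :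
    UniqueLift e m ↔ HasLiftingProperty e m ∧ AtMostOneLift e m := by
  refine ⟨fun h ↦ ⟨⟨fun {u v} sq ↦ ?_⟩, fun d₁ d₂ h₁ h₂ ↦ ?_⟩, fun ⟨_, h⟩ u v w ↦ ?_⟩
  · obtain ⟨d, ⟨h₁, h₂⟩, -⟩ := h u v sq.w
    exact ⟨⟨d, h₁, h₂⟩⟩
  · exact (h (e ≫ d₂) (d₂ ≫ m) (by simp)).unique ⟨h₁, h₂⟩ ⟨rfl, rfl⟩
  · have sq : CommSq u e m v := ⟨w⟩
    exact ⟨sq.lift, by simp, fun d ⟨h₁, h₂⟩ ↦ h (by simp [h₁]) (by simp [h₂])⟩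

lemma AtMostOneLift.of_relativeCellComplex {J : Type*} [LinearOrder J] [OrderBot J] [SuccOrder J]
    [WellFoundedLT J] {α : J → Type*} {A B : (j : J) → α j → C}
    {basicCell : (j : J) → (i : α j) → A j i ⟶ B j i} {X Y : C} {e : X ⟶ Y}
    (c : RelativeCellComplex.{v} basicCell e) {Z W : C} {m : Z ⟶ W}
    (h : ∀ j i, AtMostOneLift (basicCell j i) m) : AtMostOneLift e m := by
  intro d₁ d₂ h₁ h₂
  refine c.isColimit.hom_ext (fun j ↦ ?_)
  change c.incl.app j ≫ d₁ = c.incl.app j ≫ d₂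
  induction j using SuccOrder.limitRecOn with
  | isMin j hj =>
    obtain rfl := hj.eq_bot
    simpa [← cancel_epi c.isoBot.inv] using h₁
  | succ j hj hj' =>
    have w : c.F.map (homOfLE (Order.le_succ j)) ≫ c.incl.app (Order.succ j) ≫ d₁ =
        c.F.map (homOfLE (Order.le_succ j)) ≫ c.incl.app (Order.succ j) ≫ d₂ := by
      simpa using hj'
    refine (c.attachCells j hj).hom_ext w (fun i ↦ h _ _ ?_ (by simp [h₂]))
    simp only [AttachCells.cell_def, Category.assoc, ← (c.attachCells j hj).hm_assoc,
      ← (c.attachCells j hj).isPushout.w_assoc, w]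
  | isSuccLimit j hj hj' =>
    exact (c.F.isColimitOfIsWellOrderContinuous j hj).hom_ext
      (fun ⟨k, hk⟩ ↦ by
        have w : c.F.map (homOfLE hk.le) ≫ c.incl.app j = c.incl.app k := by simp
        change c.F.map (homOfLE hk.le) ≫ _ = c.F.map (homOfLE hk.le) ≫ _
        rw [← Category.assoc, ← Category.assoc, w, hj' k hk])

lemma exists_factorization_atMostOneLift (I : MorphismProperty C) [HasSmallObjectArgument.{v} I]
    {X Y : C} (f : X ⟶ Y) :
    ∃ (Z : C) (e : X ⟶ Z) (m : Z ⟶ Y), I.rlp.llp e ∧ I.rlp m ∧ e ≫ m = f ∧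
      ∀ ⦃Z' W : C⦄ (p : Z' ⟶ W), (∀ ⦃A B : C⦄ (i : A ⟶ B), I i → AtMostOneLift i p) →
        AtMostOneLift e p := by
  obtain ⟨κ, _, _, _⟩ := HasSmallObjectArgument.exists_cardinal.{v} (I := I)
  exact ⟨_, SmallObject.ιObj I κ f, SmallObject.πObj I κ f,
    SmallObject.llp_rlp_ιObj _ _ f, SmallObject.rlp_πObj _ _ f, SmallObject.ιObj_πObj _ _ f,
    fun _ _ _ h ↦ AtMostOneLift.of_relativeCellComplex
      (SmallObject.relativeCellComplexιObj I κ f) (fun _ i ↦ h _ i.2)⟩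

section Codiagonal

variable [HasPushouts C]

/-- The codiagonal `B ⨿_A B ⟶ B` of a morphism `A ⟶ B`. -/
noncomputable def codiagonal {A B : C} (i : A ⟶ B) : pushout i i ⟶ B :=
  pushout.desc (𝟙 B) (𝟙 B) rfl

lemma inl_codiagonal {A B : C} (i : A ⟶ B) : pushout.inl i i ≫ codiagonal i = 𝟙 B :=
  pushout.inl_desc _ _ _

lemma inl_codiagonal_assoc {A B Z : C} (i : A ⟶ B) (h : B ⟶ Z) :
    pushout.inl i i ≫ codiagonal i ≫ h = h := by
  rw [← Category.assoc, inl_codiagonal, Category.id_comp]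

lemma inr_codiagonal {A B : C} (i : A ⟶ B) : pushout.inr i i ≫ codiagonal i = 𝟙 B :=
  pushout.inr_desc _ _ _

lemma inr_codiagonal_assoc {A B Z : C} (i : A ⟶ B) (h : B ⟶ Z) :
    pushout.inr i i ≫ codiagonal i ≫ h = h := by
  rw [← Category.assoc, inr_codiagonal, Category.id_comp]

instance {A B : C} (i : A ⟶ B) : IsSplitEpi (codiagonal i) :=
  ⟨⟨pushout.inl i i, inl_codiagonal i⟩⟩

lemma hasLiftingProperty_codiagonal_iff {A B X Y : C} (i : A ⟶ B) (m : X ⟶ Y) :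
    HasLiftingProperty (codiagonal i) m ↔ AtMostOneLift i m := by
  refine ⟨fun _ d₁ d₂ h₁ h₂ ↦ ?_, fun h ↦ ⟨fun {u v} sq ↦ ?_⟩⟩
  · have sq : CommSq (pushout.desc d₁ d₂ h₁) (codiagonal i) m (d₁ ≫ m) :=
      ⟨by ext <;> simp only [inl_codiagonal_assoc, inr_codiagonal_assoc,
        pushout.inl_desc_assoc, pushout.inr_desc_assoc, h₂]⟩
    have hl := pushout.inl i i ≫= sq.fac_left
    have hr := pushout.inr i i ≫= sq.fac_left
    simp only [inl_codiagonal_assoc, inr_codiagonal_assoc, pushout.inl_desc,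
      pushout.inr_desc] at hl hr
    exact hl.symm.trans hr
  · have hl := pushout.inl i i ≫= sq.w
    have hr := pushout.inr i i ≫= sq.w
    simp only [inl_codiagonal_assoc, inr_codiagonal_assoc] at hl hr
    have w : pushout.inl i i ≫ u = pushout.inr i i ≫ u :=
      h (by simp only [pushout.condition_assoc]) (by simp only [Category.assoc, hl, hr])
    exact ⟨⟨pushout.inl i i ≫ u, by ext <;> simp [inl_codiagonal_assoc, inr_codiagonal_assoc, w], by simp [hl]⟩⟩

lemma rlp_sup_codiagonal_iff {ι : Type*} {A B : ι → C} (g : ∀ i, A i ⟶ B i) {X Y : C}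
    (m : X ⟶ Y) :
    (ofHoms g ⊔ ofHoms (fun i ↦ codiagonal (g i))).rlp m ↔ rightOrth g m := by
  simp only [rightOrth, uniqueLift_iff, ← hasLiftingProperty_codiagonal_iff]
  refine ⟨fun h i ↦ ⟨h _ (Or.inl ⟨i⟩), h _ (Or.inr ⟨i⟩)⟩, fun h ↦ ?_⟩
  rintro _ _ _ (⟨⟨i⟩⟩ | ⟨⟨i⟩⟩)
  exacts [(h i).1, (h i).2]

end Codiagonal

lemma UniqueLift.of_isIso_left {A B X Y : C} (e : A ⟶ B) [IsIso e] (m : X ⟶ Y) :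
    UniqueLift e m :=
  (uniqueLift_iff e m).2 ⟨inferInstance, fun _ _ h _ ↦ (cancel_epi e).1 h⟩

lemma UniqueLift.of_isIso_right {A B X Y : C} (e : A ⟶ B) (m : X ⟶ Y) [IsIso m] :
    UniqueLift e m :=
  (uniqueLift_iff e m).2 ⟨inferInstance, fun _ _ _ h ↦ (cancel_mono m).1 h⟩

lemma UniqueLift.comp_left {A B D X Y : C} {e : A ⟶ B} {e' : B ⟶ D} {m : X ⟶ Y}
    (h : UniqueLift e m) (h' : UniqueLift e' m) : UniqueLift (e ≫ e') m := by
  rw [uniqueLift_iff] at *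
  obtain ⟨_, h⟩ := h
  obtain ⟨_, h'⟩ := h'
  exact ⟨inferInstance, fun d₁ d₂ h₁ h₂ ↦
    h' (h (by simpa using h₁) (by simp [h₂])) h₂⟩

lemma UniqueLift.comp_right {A B X Y Z : C} {e : A ⟶ B} {m : X ⟶ Y} {m' : Y ⟶ Z}
    (h : UniqueLift e m) (h' : UniqueLift e m') : UniqueLift e (m ≫ m') := by
  rw [uniqueLift_iff] at *
  obtain ⟨_, h⟩ := h
  obtain ⟨_, h'⟩ := h'
  exact ⟨inferInstance, fun d₁ d₂ h₁ h₂ ↦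
    h h₁ (h' (by rw [← Category.assoc, ← Category.assoc, h₁]) (by simpa using h₂))⟩

lemma exists_orthogonal_factorization [IsLocallyPresentable.{v} C] [HasColimits C]
    {ι : Type v} {A B : ι → C} (g : ∀ i, A i ⟶ B i) {X Y : C} (f : X ⟶ Y) :
    ∃ (Z : C) (e : X ⟶ Z) (m : Z ⟶ Y), leftRightOrth g e ∧ rightOrth g m ∧ e ≫ m = f := by
  let I := ofHoms g ⊔ ofHoms (fun i ↦ codiagonal (g i))
  have : MorphismProperty.IsSmall.{v} I := isSmall_sup _ _
  have := hasSmallObjectArgument I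
  obtain ⟨Z, e, m, he, hm, fac, huniq⟩ := exists_factorization_atMostOneLift I f
  refine ⟨Z, e, m, fun X' Y' p hp ↦ (uniqueLift_iff e p).2
    ⟨he _ ((rlp_sup_codiagonal_iff g p).2 hp), huniq p ?_⟩,
    (rlp_sup_codiagonal_iff g m).1 hm, fac⟩
  rintro _ _ _ (⟨⟨i⟩⟩ | ⟨⟨i⟩⟩)
  · exact ((uniqueLift_iff _ _).1 (hp i)).2
  · exact fun _ _ h _ ↦ (cancel_epi _).1 h

/-- In a locally presentable category, for any set `Λ` of morphisms the pair
`(l r(Λ), r(Λ))` is an orthogonal factorization system: both classes contain all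
isomorphisms and are closed under composition, every morphism factors as a morphism in
`l r(Λ)` followed by one in `r(Λ)`, and `l r(Λ) ⊥ r(Λ)`. -/
theorem statement8 {C : Type u} [Category.{v} C]
    (hC : ∃ κ : Cardinal.{v}, κ.IsRegular ∧ LocallyPresentable κ C)
    {ι : Type v} {A B : ι → C} (g : ∀ i, A i ⟶ B i) :
    (∀ {X Y : C} (e : X ⟶ Y), IsIso e → leftRightOrth g e) ∧
    (∀ {X Y : C} (m : X ⟶ Y), IsIso m → rightOrth g m) ∧
    (∀ {X Y Z : C} (e : X ⟶ Y) (e' : Y ⟶ Z),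
      leftRightOrth g e → leftRightOrth g e' → leftRightOrth g (e ≫ e')) ∧
    (∀ {X Y Z : C} (m : X ⟶ Y) (m' : Y ⟶ Z),
      rightOrth g m → rightOrth g m' → rightOrth g (m ≫ m')) ∧
    (∀ {X Y : C} (f : X ⟶ Y), ∃ (Z : C) (e : X ⟶ Z) (m : Z ⟶ Y),
      leftRightOrth g e ∧ rightOrth g m ∧ e ≫ m = f) ∧
    (∀ {X Y X' Y' : C} (e : X ⟶ Y) (m : X' ⟶ Y'),
      leftRightOrth g e → rightOrth g m → UniqueLift e m) := by
  obtain ⟨κ, hκ, hC⟩ := hC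
  have : Fact κ.IsRegular := ⟨hκ⟩
  have := hC.isCardinalLocallyPresentable
  have := hC.1
  have : IsLocallyPresentable.{v} C := ⟨κ, inferInstance, inferInstance⟩
  exact ⟨fun e _ _ _ m _ ↦ .of_isIso_left e m, fun m _ _ ↦ .of_isIso_right _ m,
    fun _ _ h h' _ _ m hm ↦ (h m hm).comp_left (h' m hm),
    fun _ _ h h' i ↦ (h i).comp_right (h' i),
    exists_orthogonal_factorization g, fun _ m h hm ↦ h m hm⟩

end Paper
end

section
/- Let H : 𝒞 → 𝒞 be a λ-accessible (λ-filtered-colimit-preserving) endofunctor on a cocomplete locally small category 𝒞. Then the forgetful functor U : Alg(H) → 𝒞 has a left adjoint, and the resulting adjunction is strictly monadic with a λ-accessible induced monad. -/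
open CategoryTheory CategoryTheory.Limits Opposite

universe w v u

namespace Paper

variable {C : Type u} [Category.{v} C]

open Endofunctor

section Desc

variable {K : Type w} [Category.{w} K] {D : K ⥤ C} {c : Cocone D} (hc : IsColimit c)

/-- The morphism from a colimit induced by a compatible family of morphisms. -/
def descOfCompatible {T : C} (s : ∀ k, D.obj k ⟶ T)
    (hs : ∀ ⦃k l⦄ (f : k ⟶ l), D.map f ≫ s l = s k) : c.pt ⟶ T :=
  hc.desc
    { pt := T
      ι :=
        { app := s
          naturality _ _ f := (hs f).trans (Category.comp_id _).symm } }

lemma ι_descOfCompatible {T : C} (s : ∀ k, D.obj k ⟶ T)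
    (hs : ∀ ⦃k l⦄ (f : k ⟶ l), D.map f ≫ s l = s k) (k : K) :
    c.ι.app k ≫ descOfCompatible hc s hs = s k :=
  hc.fac _ k

end Desc

section Coalgebra

variable {G : C ⥤ C}

section Colimits

variable {K : Type w} [Category.{w} K] {D : K ⥤ Coalgebra G}

/-- The components of a cocone on the carriers of a diagram of coalgebras. -/
def carrierι (c : Cocone (D ⋙ Coalgebra.forget G)) (k : K) : (D.obj k).V ⟶ c.pt :=
  c.ι.app k

lemma map_carrierι (c : Cocone (D ⋙ Coalgebra.forget G)) {k l : K} (f : k ⟶ l) :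
    (D.map f).f ≫ carrierι c l = carrierι c k :=
  c.w f

lemma carrier_hom_ext {c : Cocone (D ⋙ Coalgebra.forget G)} (hc : IsColimit c) {T : C}
    {f g : c.pt ⟶ T} (h : ∀ k, carrierι c k ≫ f = carrierι c k ≫ g) : f = g :=
  hc.hom_ext h

variable {c : Cocone (D ⋙ Coalgebra.forget G)} (hc : IsColimit c)

/-- The morphism from a colimit of carriers of coalgebras induced by a compatible family. -/
def carrierDesc {T : C} (s : ∀ k, (D.obj k).V ⟶ T)
    (hs : ∀ ⦃k l⦄ (f : k ⟶ l), (D.map f).f ≫ s l = s k) : c.pt ⟶ T :=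
  descOfCompatible hc s hs

lemma carrierι_desc {T : C} (s : ∀ k, (D.obj k).V ⟶ T)
    (hs : ∀ ⦃k l⦄ (f : k ⟶ l), (D.map f).f ≫ s l = s k) (k : K) :
    carrierι c k ≫ carrierDesc hc s hs = s k :=
  ι_descOfCompatible hc s hs k

lemma str_compatible (c : Cocone (D ⋙ Coalgebra.forget G)) ⦃k l : K⦄ (f : k ⟶ l) :
    (D.map f).f ≫ (D.obj l).str ≫ G.map (carrierι c l) =
      (D.obj k).str ≫ G.map (carrierι c k) := by
  rw [← Coalgebra.Hom.h_assoc, ← G.map_comp, map_carrierι]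

/-- The coalgebra structure on a colimit of the carriers of a diagram of coalgebras. -/
abbrev colimitCoalgebra : Coalgebra G where
  V := c.pt
  str := carrierDesc hc (fun k ↦ (D.obj k).str ≫ G.map (carrierι c k)) (str_compatible c)

lemma carrierι_colimitCoalgebra_str (k : K) :
    carrierι c k ≫ (colimitCoalgebra hc).str = (D.obj k).str ≫ G.map (carrierι c k) :=
  carrierι_desc hc _ (str_compatible c) k

/-- The cocone with point `colimitCoalgebra hc`. -/
abbrev colimitCoalgebraCocone : Cocone D where
  pt := colimitCoalgebra hc
  ι :=
    { app k := { f := carrierι c k, h := (carrierι_colimitCoalgebra_str hc k).symm }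
      naturality k l f := by
        ext
        exact c.ι.naturality f }

lemma cocone_map_f (s : Cocone D) {k l : K} (f : k ⟶ l) :
    (D.map f).f ≫ (s.ι.app l).f = (s.ι.app k).f :=
  congr_arg Coalgebra.Hom.f (s.w f)

/-- Colimits of coalgebras are computed on the carriers. -/
def isColimitColimitCoalgebraCocone : IsColimit (colimitCoalgebraCocone hc) where
  desc s :=
    { f := carrierDesc hc (fun k ↦ (s.ι.app k).f) fun _ _ f ↦ cocone_map_f s f
      h := carrier_hom_ext hc fun k ↦ by
        rw [reassoc_of% (carrierι_colimitCoalgebra_str hc), ← G.map_comp, carrierι_desc,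
          reassoc_of% carrierι_desc]
        exact (s.ι.app k).h }
  fac s k := Coalgebra.ext (carrierι_desc hc _ (fun _ _ f ↦ cocone_map_f s f) k)
  uniq s m hm := by
    ext
    refine carrier_hom_ext hc fun k ↦ ?_
    rw [carrierι_desc, ← hm]
    rfl

end Colimits

instance hasColimitsOfSize_coalgebra [HasColimitsOfSize.{w, w} C] :
    HasColimitsOfSize.{w, w} (Coalgebra G) where
  has_colimits_of_shape _ _ :=
    { has_colimit D :=
        ⟨⟨⟨_, isColimitColimitCoalgebraCocone (colimit.isColimit (D ⋙ Coalgebra.forget G))⟩⟩⟩ }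

variable (G) in
/-- A coalgebra is recursive if it has a unique coalgebra-to-algebra morphism to every
algebra. -/
def IsRecursive : ObjectProperty (Coalgebra G) := fun X ↦
  ∀ A : Algebra G, ∃! h : X.V ⟶ A.a, X.str ≫ G.map h ≫ A.str = h

lemma IsRecursive.colimitCoalgebra {K : Type w} [Category.{w} K] {D : K ⥤ Coalgebra G}
    {c : Cocone (D ⋙ Coalgebra.forget G)} (hc : IsColimit c)
    (hD : ∀ k, IsRecursive G (D.obj k)) : IsRecursive G (colimitCoalgebra hc) := by
  intro A
  choose h hh hu using fun k ↦ hD k A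
  have compat ⦃k l : K⦄ (f : k ⟶ l) : (D.map f).f ≫ h l = h k := by
    apply hu
    rw [G.map_comp, Category.assoc, Coalgebra.Hom.h_assoc, hh]
  refine ⟨carrierDesc hc h compat, carrier_hom_ext hc fun k ↦ ?_,
    fun g hg ↦ carrier_hom_ext hc fun k ↦ ?_⟩
  · rw [reassoc_of% (carrierι_colimitCoalgebra_str hc), ← G.map_comp_assoc, carrierι_desc, hh]
  · rw [carrierι_desc]
    apply hu
    rw [G.map_comp, Category.assoc, ← reassoc_of% (carrierι_colimitCoalgebra_str hc), hg]

lemma IsRecursive.of_iso {X Y : Coalgebra G} (e : X ≅ Y) (hX : IsRecursive G X) :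
    IsRecursive G Y := by
  have hi : e.inv.f ≫ e.hom.f = 𝟙 _ := congr_arg Coalgebra.Hom.f e.inv_hom_id
  intro A
  obtain ⟨h, hh, hu⟩ := hX A
  refine ⟨e.inv.f ≫ h, ?_, fun g hg ↦ ?_⟩
  · dsimp
    rw [G.map_comp, Category.assoc, Coalgebra.Hom.h_assoc, hh]
  · rw [← hu (e.hom.f ≫ g) (by
      dsimp only
      rw [G.map_comp, Category.assoc, Coalgebra.Hom.h_assoc, hg]),
      reassoc_of% hi]

instance isClosedUnderColimitsOfShape_isRecursive (K : Type w) [Category.{w} K]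
    [HasColimitsOfShape K C] :
    (IsRecursive G).IsClosedUnderColimitsOfShape K where
  colimitsOfShape_le := by
    rintro X ⟨p⟩
    exact (IsRecursive.colimitCoalgebra (colimit.isColimit (p.diag ⋙ Coalgebra.forget G))
      p.prop_diag_obj).of_iso
        ((isColimitColimitCoalgebraCocone _).coconePointUniqueUpToIso p.isColimit)

instance hasColimitsOfSize_isRecursive [HasColimitsOfSize.{w, w} C] :
    HasColimitsOfSize.{w, w} (IsRecursive G).FullSubcategory where
  has_colimits_of_shape _ _ := inferInstance

/-- The coalgebra `G X ⟶ G (G X)` associated to a coalgebra `X ⟶ G X`. -/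
abbrev succCoalgebra (X : Coalgebra G) : Coalgebra G where
  V := G.obj X.V
  str := G.map X.str

/-- The structure morphism of a coalgebra, as a morphism of coalgebras. -/
def toSuccCoalgebra (X : Coalgebra G) : X ⟶ succCoalgebra X where
  f := X.str

lemma IsRecursive.succCoalgebra {X : Coalgebra G} (hX : IsRecursive G X) :
    IsRecursive G (succCoalgebra X) := by
  intro A
  obtain ⟨h, hh, hu⟩ := hX A
  dsimp at hh hu
  refine ⟨G.map h ≫ A.str, ?_, fun g hg ↦ ?_⟩
  · dsimp
    rw [← G.map_comp_assoc, hh]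
  · dsimp at g hg
    rw [← hu (X.str ≫ g) (by rw [G.map_comp, Category.assoc, hg]), G.map_comp, Category.assoc, hg]

/-- A recursive coalgebra whose structure morphism is invertible is an initial algebra. -/
noncomputable def IsRecursive.isInitial {X : Coalgebra G} (hX : IsRecursive G X) [IsIso X.str] :
    IsInitial (⟨X.V, inv X.str⟩ : Algebra G) :=
  have key (A : Algebra G) (h : X.V ⟶ A.a) :
      G.map h ≫ A.str = inv X.str ≫ h ↔ X.str ≫ G.map h ≫ A.str = h := by
    rw [IsIso.eq_inv_comp]
  IsInitial.ofUniqueHom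
    (fun A ↦ { f := (hX A).choose, h := (key A _).2 (hX A).choose_spec.1 })
    (fun A m ↦ Algebra.ext ((hX A).choose_spec.2 _ ((key A _).1 m.h)))

variable (G) in
/-- Iterating `succCoalgebra` on recursive coalgebras, starting from an initial object. -/
noncomputable def recursiveSuccStruct [HasColimitsOfSize.{w, w} C] :
    SmallObject.SuccStruct (IsRecursive G).FullSubcategory where
  X₀ := colimit (Functor.empty.{w} _)
  succ X := ⟨succCoalgebra X.obj, X.property.succCoalgebra⟩
  toSucc X := ObjectProperty.homMk (toSuccCoalgebra X.obj)

variable (G) in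
lemma exists_chain (J : Type w) [LinearOrder J] [OrderBot J] [SuccOrder J] [WellFoundedLT J]
    [NoMaxOrder J] [HasColimitsOfSize.{w, w} C] :
    ∃ (Φ : J ⥤ Coalgebra G) (e : ∀ j, succCoalgebra (Φ.obj j) ⟶ Φ.obj (Order.succ j)),
      (∀ j, IsRecursive G (Φ.obj j)) ∧
      ∀ j, Φ.map (homOfLE (Order.le_succ j)) = toSuccCoalgebra _ ≫ e j :=
  ⟨(recursiveSuccStruct G).iterationFunctor J ⋙ (IsRecursive G).ι,
    fun j ↦ (((recursiveSuccStruct G).iterationFunctorObjSuccIso j (not_isMax j)).inv).hom,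
    fun _ ↦ ObjectProperty.FullSubcategory.property _,
    fun j ↦ congr_arg (IsRecursive G).ι.map
      ((recursiveSuccStruct G).iterationFunctor_map_succ j (not_isMax j))⟩

lemma hasInitial_algebra (J : Type w) [LinearOrder J] [OrderBot J] [SuccOrder J]
    [WellFoundedLT J] [NoMaxOrder J] [HasColimitsOfSize.{w, w} C]
    [PreservesColimitsOfShape J G] : HasInitial (Algebra G) := by
  obtain ⟨Φ, e, hΦ, he⟩ := exists_chain G J
  let c := colimit.cocone (Φ ⋙ Coalgebra.forget G)
  let hc : IsColimit c := colimit.isColimit _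
  have hW : IsRecursive G (colimitCoalgebra hc) := .colimitCoalgebra hc hΦ
  have hsucc (j : J) : (Φ.obj j).str ≫ (e j).f = (Φ.map (homOfLE (Order.le_succ j))).f := by
    rw [he]; rfl
  have hstr (j : J) : (e j).f ≫ (Φ.obj (Order.succ j)).str =
      G.map (Φ.map (homOfLE (Order.le_succ j))).f := by
    rw [← Coalgebra.Hom.h, ← G.map_comp, hsucc]
  have compat ⦃j k : J⦄ (f : j ⟶ k) :
      G.map (Φ.map f).f ≫ (e k).f ≫ carrierι c (Order.succ k) =
        (e j).f ≫ carrierι c (Order.succ j) := by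
    obtain rfl | h := (leOfHom f).eq_or_lt
    · obtain rfl : f = 𝟙 _ := Subsingleton.elim _ _
      rw [Φ.map_id, Coalgebra.id_f, G.map_id, Category.id_comp]
    · let g := homOfLE (Order.succ_le_of_lt h)
      obtain rfl : f = homOfLE (Order.le_succ j) ≫ g := Subsingleton.elim _ _
      rw [Φ.map_comp, Coalgebra.comp_f, G.map_comp, ← hstr, Category.assoc, Category.assoc,
        Coalgebra.Hom.h_assoc, reassoc_of% (hsucc k), map_carrierι, map_carrierι]
  let hGc := isColimitOfPreserves G hc
  let r : G.obj c.pt ⟶ c.pt :=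
    descOfCompatible hGc (fun j ↦ (e j).f ≫ carrierι c (Order.succ j)) compat
  have fac (j : J) : G.map (carrierι c j) ≫ r = (e j).f ≫ carrierι c (Order.succ j) :=
    ι_descOfCompatible hGc _ compat j
  have h1 : (colimitCoalgebra hc).str ≫ r = 𝟙 _ := carrier_hom_ext hc fun j ↦ by
    rw [reassoc_of% (carrierι_colimitCoalgebra_str hc), fac, reassoc_of% (hsucc j), map_carrierι,
      Category.comp_id]
  have h2' (j : J) : G.map (carrierι c j) ≫ r ≫ (colimitCoalgebra hc).str =
      G.map (carrierι c j) ≫ 𝟙 _ := by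
    rw [reassoc_of% (fac j), carrierι_colimitCoalgebra_str, reassoc_of% (hstr j), ← G.map_comp,
      map_carrierι, Category.comp_id]
  have h2 : r ≫ (colimitCoalgebra hc).str = 𝟙 _ := hGc.hom_ext h2'
  have : IsIso (colimitCoalgebra hc).str := ⟨r, h1, h2⟩
  exact hW.isInitial.hasInitial

end Coalgebra

section Free

variable [HasBinaryCoproducts C] {H : C ⥤ C}

variable (H) in
/-- The endofunctor `Y ↦ X ⨿ H Y`, whose initial algebra is the free `H`-algebra on `X`. -/
noncomputable abbrev coprodFunctor (X : C) : C ⥤ C where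
  obj Y := X ⨿ H.obj Y
  map f := coprod.map (𝟙 X) (H.map f)

lemma preservesColimitsOfShape_coprodFunctor (X : C) (J : Type w) [Preorder J] [OrderBot J]
    [PreservesColimitsOfShape J H] : PreservesColimitsOfShape J (coprodFunctor H X) where
  preservesColimit {D} :=
    { preserves {c} hc := ⟨by
        let hHc := isColimitOfPreserves H hc
        let s' (s : Cocone (D ⋙ coprodFunctor H X)) (j : J) : X ⨿ H.obj (D.obj j) ⟶ s.pt :=
          s.ι.app j
        have hs' (s : Cocone (D ⋙ coprodFunctor H X)) ⦃j k : J⦄ (f : j ⟶ k) :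
            coprod.map (𝟙 X) (H.map (D.map f)) ≫ s' s k = s' s j := s.w f
        have compat (s : Cocone (D ⋙ coprodFunctor H X)) ⦃j k : J⦄ (f : j ⟶ k) :
            H.map (D.map f) ≫ coprod.inr ≫ s' s k = coprod.inr ≫ s' s j := by
          rw [← hs' s f, coprod.inr_map_assoc]
        have hbot (s : Cocone (D ⋙ coprodFunctor H X)) (j : J) :
            coprod.inl ≫ s' s ⊥ = coprod.inl ≫ s' s j := by
          rw [← hs' s (homOfLE (bot_le : ⊥ ≤ j)), coprod.inl_map_assoc, Category.id_comp]
        let d (s : Cocone (D ⋙ coprodFunctor H X)) : H.obj c.pt ⟶ s.pt :=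
          descOfCompatible hHc (fun j ↦ coprod.inr ≫ s' s j) (compat s)
        let ι (j : J) : D.obj j ⟶ c.pt := c.ι.app j
        have hd (s : Cocone (D ⋙ coprodFunctor H X)) (j : J) :
            H.map (ι j) ≫ d s = coprod.inr ≫ s' s j :=
          ι_descOfCompatible hHc _ (compat s) j
        have hfac (s : Cocone (D ⋙ coprodFunctor H X)) (j : J) :
            coprod.map (𝟙 X) (H.map (ι j)) ≫ coprod.desc (coprod.inl ≫ s' s ⊥) (d s) = s' s j := by
          rw [coprod.map_desc, Category.id_comp, hd]
          apply coprod.hom_ext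
          · rw [coprod.inl_desc, hbot s j]
          · rw [coprod.inr_desc]
        have huniq (s : Cocone (D ⋙ coprodFunctor H X)) (m : X ⨿ H.obj c.pt ⟶ s.pt)
            (hm : ∀ j, coprod.map (𝟙 X) (H.map (ι j)) ≫ m = s' s j) :
            m = coprod.desc (coprod.inl ≫ s' s ⊥) (d s) := by
          apply coprod.hom_ext
          · rw [coprod.inl_desc, ← hm, coprod.inl_map_assoc, Category.id_comp]
          · have key (j : J) : H.map (ι j) ≫ coprod.inr ≫ m = H.map (ι j) ≫ d s := by
              rw [hd, ← hm, coprod.inr_map_assoc]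
            rw [coprod.inr_desc]
            exact hHc.hom_ext key
        exact
          { desc s := coprod.desc (coprod.inl ≫ s' s ⊥) (d s)
            fac := hfac
            uniq := huniq }⟩ }

lemma hasInitial_structuredArrow_forget (X : C) [HasInitial (Algebra (coprodFunctor H X))] :
    HasInitial (StructuredArrow X (Algebra.forget H)) := by
  let I : Algebra (coprodFunctor H X) := ⊥_ _
  have hI : IsInitial I := initialIsInitial
  let str : X ⨿ H.obj I.a ⟶ I.a := I.str
  let S : StructuredArrow X (Algebra.forget H) :=
    StructuredArrow.mk (Y := ⟨I.a, coprod.inr ≫ str⟩) (coprod.inl ≫ str)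
  let t (T : StructuredArrow X (Algebra.forget H)) : X ⟶ T.right.a := T.hom
  let toAlg (T : StructuredArrow X (Algebra.forget H)) : Algebra (coprodFunctor H X) :=
    ⟨T.right.a, coprod.desc (t T) T.right.str⟩
  have key (T : StructuredArrow X (Algebra.forget H)) (f : I.a ⟶ T.right.a) :
      coprod.map (𝟙 X) (H.map f) ≫ coprod.desc (t T) T.right.str = str ≫ f ↔
        (coprod.inl ≫ str) ≫ f = t T ∧ H.map f ≫ T.right.str = (coprod.inr ≫ str) ≫ f := by
    rw [coprod.map_desc, Category.id_comp, Category.assoc, Category.assoc]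
    refine ⟨fun h ↦ ?_, fun h ↦ ?_⟩
    · rw [← h, coprod.inl_desc, coprod.inr_desc]
      exact ⟨rfl, rfl⟩
    · apply coprod.hom_ext
      · rw [coprod.inl_desc, h.1]
      · rw [coprod.inr_desc, h.2]
  have hS : IsInitial S := IsInitial.ofUniqueHom
    (fun T ↦ StructuredArrow.homMk
      { f := (hI.to (toAlg T)).f
        h := ((key T _).1 (hI.to (toAlg T)).h).2 }
      ((key T _).1 (hI.to (toAlg T)).h).1)
    (fun T m ↦ by
      let m' : I ⟶ toAlg T :=
        { f := m.right.f
          h := (key T _).2 ⟨StructuredArrow.w m, m.right.h⟩ }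
      have hm' : m' = hI.to _ := hI.hom_ext _ _
      have hm : m.right.f = (hI.to (toAlg T)).f := congr_arg Algebra.Hom.f hm'
      ext
      exact hm)
  exact hS.hasInitial

end Free

section Monadic

variable {H : C ⥤ C} {F : C ⥤ Algebra H} (adj : F ⊣ Algebra.forget H)

/-- The insertion of generators into a free algebra. -/
def generators (X : C) : X ⟶ (F.obj X).a := adj.unit.app X

lemma generators_naturality {X Y : C} (f : X ⟶ Y) :
    f ≫ generators adj Y = generators adj X ≫ (F.map f).f :=
  adj.unit.naturality f

lemma free_hom_ext {X : C} {A : Algebra H} {f g : F.obj X ⟶ A}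
    (h : generators adj X ≫ f.f = generators adj X ≫ g.f) : f = g :=
  (adj.homEquiv X A).injective
    ((adj.homEquiv_unit ..).trans (h.trans (adj.homEquiv_unit ..).symm))

/-- The evaluation of the free algebra on the carrier of an algebra. -/
def evaluation (A : Algebra H) : F.obj A.a ⟶ A := adj.counit.app A

lemma generators_evaluation (A : Algebra H) :
    generators adj A.a ≫ (evaluation adj A).f = 𝟙 _ :=
  adj.right_triangle_components A

/-- The canonical morphisms from `H` to the free monad on `H`. -/
def toFreeMonad (X : C) : H.obj X ⟶ (F.obj X).a :=
  H.map (generators adj X) ≫ (F.obj X).str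

lemma toFreeMonad_naturality {X Y : C} (f : X ⟶ Y) :
    H.map f ≫ toFreeMonad adj Y = toFreeMonad adj X ≫ (F.map f).f := by
  rw [toFreeMonad, toFreeMonad, ← H.map_comp_assoc, generators_naturality, H.map_comp,
    Category.assoc, Category.assoc, Algebra.Hom.h]

lemma toFreeMonad_evaluation (A : Algebra H) :
    toFreeMonad adj A.a ≫ (evaluation adj A).f = A.str := by
  rw [toFreeMonad, Category.assoc, ← Algebra.Hom.h, ← H.map_comp_assoc, generators_evaluation,
    H.map_id, Category.id_comp]

/-- The action of the free monad on an algebra over it. -/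
def freeAction (B : adj.toMonad.Algebra) : (F.obj B.A).a ⟶ B.A := B.a

lemma freeAction_assoc (B : adj.toMonad.Algebra) :
    (evaluation adj (F.obj B.A)).f ≫ freeAction adj B =
      (F.map (freeAction adj B)).f ≫ freeAction adj B :=
  B.assoc

/-- The underlying algebra of the endofunctor of an algebra over the free monad. -/
abbrev algebraOfMonadAlgebra (B : adj.toMonad.Algebra) : Algebra H where
  a := B.A
  str := toFreeMonad adj B.A ≫ freeAction adj B

lemma evaluation_algebraOfMonadAlgebra (B : adj.toMonad.Algebra) :
    (evaluation adj (algebraOfMonadAlgebra adj B)).f = freeAction adj B := by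
  let g : F.obj B.A ⟶ algebraOfMonadAlgebra adj B :=
    { f := freeAction adj B
      h := by
        rw [reassoc_of% toFreeMonad_naturality, ← freeAction_assoc, reassoc_of% toFreeMonad_evaluation] }
  have hg : evaluation adj (algebraOfMonadAlgebra adj B) = g :=
    free_hom_ext adj
      ((generators_evaluation adj (algebraOfMonadAlgebra adj B)).trans B.unit.symm)
  exact congr_arg Algebra.Hom.f hg

lemma comparison_algebraOfMonadAlgebra (B : adj.toMonad.Algebra) :
    (Monad.comparison adj).obj (algebraOfMonadAlgebra adj B) = B := by
  have h := evaluation_algebraOfMonadAlgebra adj B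
  obtain ⟨X, x, hη, hμ⟩ := B
  change Monad.Algebra.mk X _ _ _ = _
  congr 1

lemma algebraOfMonadAlgebra_comparison (A : Algebra H) :
    algebraOfMonadAlgebra adj ((Monad.comparison adj).obj A) = A :=
  congr_arg (Endofunctor.Algebra.mk A.a) (toFreeMonad_evaluation adj A)

lemma bijective_comparison_obj : Function.Bijective (Monad.comparison adj).obj :=
  Function.bijective_iff_has_inverse.2
    ⟨algebraOfMonadAlgebra adj, algebraOfMonadAlgebra_comparison adj,
      comparison_algebraOfMonadAlgebra adj⟩

lemma isEquivalence_comparison : (Monad.comparison adj).IsEquivalence where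
  full :=
    { map_surjective {A B} f := by
        let g : A.a ⟶ B.a := f.f
        have hg : (F.map g).f ≫ (evaluation adj B).f = (evaluation adj A).f ≫ g := f.h
        exact
          ⟨{ f := g
             h := by
              rw [← toFreeMonad_evaluation adj A, ← toFreeMonad_evaluation adj B,
                reassoc_of% toFreeMonad_naturality, hg, Category.assoc] }, rfl⟩ }
  essSurj := ⟨fun B ↦ ⟨_, ⟨eqToIso (comparison_algebraOfMonadAlgebra adj B)⟩⟩⟩

end Monadic

section Accessible

variable {H : C ⥤ C}

lemma preservesColimitsOfShape_forget (J : Type w) [Category.{w} J] [HasColimitsOfShape J C]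
    [PreservesColimitsOfShape J H] : PreservesColimitsOfShape J (Algebra.forget H) where
  preservesColimit {D} := by
    let c := colimit.cocone (D ⋙ Algebra.forget H)
    let hc : IsColimit c := colimit.isColimit _
    let hHc := isColimitOfPreserves H hc
    let ι (j : J) : (D.obj j).a ⟶ c.pt := c.ι.app j
    have hι ⦃j k : J⦄ (f : j ⟶ k) : (D.map f).f ≫ ι k = ι j := c.w f
    have compat ⦃j k : J⦄ (f : j ⟶ k) :
        H.map (D.map f).f ≫ (D.obj k).str ≫ ι k = (D.obj j).str ≫ ι j := by
      rw [Algebra.Hom.h_assoc, hι]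
    let str : H.obj c.pt ⟶ c.pt := descOfCompatible hHc (fun j ↦ (D.obj j).str ≫ ι j) compat
    have hstr (j : J) : H.map (ι j) ≫ str = (D.obj j).str ≫ ι j :=
      ι_descOfCompatible hHc _ compat j
    let t : Cocone D :=
      { pt := ⟨c.pt, str⟩
        ι :=
          { app j := { f := ι j, h := hstr j }
            naturality j k f := by
              ext
              exact c.ι.naturality f } }
    have hs (s : Cocone D) ⦃j k : J⦄ (f : j ⟶ k) : (D.map f).f ≫ (s.ι.app k).f = (s.ι.app j).f :=
      congr_arg Algebra.Hom.f (s.w f)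
    let desc (s : Cocone D) : c.pt ⟶ s.pt.a := descOfCompatible hc (fun j ↦ (s.ι.app j).f) (hs s)
    have hdesc (s : Cocone D) (j : J) : ι j ≫ desc s = (s.ι.app j).f :=
      ι_descOfCompatible hc _ (hs s) j
    have hdesc' (s : Cocone D) (j : J) :
        H.map (ι j) ≫ H.map (desc s) ≫ s.pt.str = H.map (ι j) ≫ str ≫ desc s := by
      rw [reassoc_of% (hstr j), ← H.map_comp_assoc, hdesc]
      exact (s.ι.app j).h
    have ht : IsColimit t :=
      { desc s := { f := desc s, h := hHc.hom_ext (hdesc' s) }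
        fac s j := by
          ext
          exact hdesc s j
        uniq s m hm := by
          ext
          exact hc.hom_ext fun j ↦ (congr_arg Algebra.Hom.f (hm j)).trans (hdesc s j).symm }
    exact preservesColimit_of_preserves_colimit_cocone ht hc

end Accessible

lemma isCardinalFiltered_ord_toType (κ : Cardinal.{v}) (hreg : κ.IsRegular) :
    IsCardinalFiltered κ κ.ord.ToType := by
  have : Fact κ.IsRegular := ⟨hreg⟩
  intro K _ hK F
  refine ⟨CategoryTheory.IsCardinalFiltered.cocone (κ := κ) F ?_⟩
  have e : Arrow K ≃ Σ (a : K) (b : K), a ⟶ b :=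
    { toFun f := ⟨f.left, f.right, f.hom⟩
      invFun f := Arrow.mk f.2.2
      left_inv _ := rfl
      right_inv _ := rfl }
  rwa [hasCardinalLT_iff_of_equiv e, hasCardinalLT_iff_cardinal_mk_lt]

/-- If `H` is a `κ`-accessible endofunctor on a cocomplete (locally small) category, then
the forgetful functor from `H`-algebras has a left adjoint, the induced monad is
`κ`-accessible, and the adjunction is strictly monadic (the Eilenberg–Moore comparison
functor is an isomorphism of categories). -/
theorem statement17 {C : Type u} [Category.{v} C] [HasColimits C]
    (κ : Cardinal.{v}) (hreg : κ.IsRegular) (H : C ⥤ C)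
    (hH : ∀ (J : Type v) [Category.{v} J], IsCardinalFiltered κ J →
      Nonempty (PreservesColimitsOfShape J H)) :
    ∃ (F : C ⥤ Endofunctor.Algebra H) (adj : F ⊣ Endofunctor.Algebra.forget H),
      (∀ (J : Type v) [Category.{v} J], IsCardinalFiltered κ J →
        Nonempty (PreservesColimitsOfShape J adj.toMonad.toFunctor)) ∧
      (Monad.comparison adj).IsEquivalence ∧
      Function.Bijective (Monad.comparison adj).obj := by
  have : (Algebra.forget H).IsRightAdjoint := by
    have : Nonempty κ.ord.ToType := by simpa using hreg.ne_zero
    let := WellFoundedLT.toOrderBot κ.ord.ToType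
    let := SuccOrder.ofLinearWellFoundedLT κ.ord.ToType
    have : NoMaxOrder κ.ord.ToType := Cardinal.noMaxOrder hreg.aleph0_le
    obtain ⟨_⟩ := hH _ (isCardinalFiltered_ord_toType κ hreg)
    have (X : C) : HasInitial (StructuredArrow X (Algebra.forget H)) :=
      have := preservesColimitsOfShape_coprodFunctor (H := H) X κ.ord.ToType
      have := hasInitial_algebra (G := coprodFunctor H X) κ.ord.ToType
      hasInitial_structuredArrow_forget X
    exact isRightAdjointOfStructuredArrowInitials _
  let adj := Adjunction.ofIsRightAdjoint (Algebra.forget H)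
  refine ⟨_, adj, fun J _ hJ ↦ ⟨?_⟩, isEquivalence_comparison adj, bijective_comparison_obj adj⟩
  obtain ⟨_⟩ := hH J hJ
  have := preservesColimitsOfShape_forget (H := H) J
  have : PreservesColimitsOfSize.{v, v} (Algebra.forget H).leftAdjoint :=
    adj.leftAdjoint_preservesColimits
  exact inferInstanceAs (PreservesColimitsOfShape J
    ((Algebra.forget H).leftAdjoint ⋙ Algebra.forget H))

end Paper
end
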